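/- arXiv:2507.12743 — 6 statements merged into one kernel-verified Lean document; each statement's English description precedes it below -/
import Mathlib

section
/- Let α : ℝ → ℝ be locally Lipschitz, strictly increasing with α(0) = 0 (an extended class K function), and let h : [0,∞) → ℝ be differentiable with h(0) ≥ 0 and h'(t) ≥ -α(h(t)) for all t ≥ 0. Then h(t) ≥ 0 for all t ≥ 0. -/
/-- An extended class K function: locally Lipschitz, strictly increasing, vanishing at 0. -/
def IsExtClassK (α : ℝ → ℝ) : Prop :=
  LocallyLipschitz α ∧ StrictMono α ∧ α 0 = 0

/-- **Scalar CBF comparison lemma.** If `h(0) ≥ 0` and `h'(t) ≥ -α(h(t))` for all `t ≥ 0`,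
where `α` is an extended class K function, then `h(t) ≥ 0` for all `t ≥ 0`. -/
theorem cbf_comparison (α : ℝ → ℝ) (hα : IsExtClassK α)
    (h h' : ℝ → ℝ)
    (hderiv : ∀ t : ℝ, 0 ≤ t → HasDerivAt h (h' t) t)
    (h0 : 0 ≤ h 0)
    (hineq : ∀ t : ℝ, 0 ≤ t → h' t ≥ -α (h t)) :
    ∀ t : ℝ, 0 ≤ t → 0 ≤ h t := by
  obtain ⟨-, hmono, hzero⟩ := hα
  intro t ht
  refine le_of_forall_pos_le_add fun ε hε => ?_
  have key : -h t ≤ ε :=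
    image_le_of_deriv_right_lt_deriv_boundary (f := fun x => -h x) (f' := fun x => -h' x)
      (B := fun _ => ε) (B' := fun _ => 0)
      (fun x hx => (hderiv x hx.1).neg.continuousAt.continuousWithinAt)
      (fun x hx => (hderiv x hx.1).neg.hasDerivWithinAt)
      (by linarith) (fun x => hasDerivAt_const x ε)
      (fun x hx hxε => by
        have hneg : h x < 0 := by linarith
        have hαneg : α (h x) < 0 := hzero ▸ hmono hneg
        linarith [hineq x hx.1])
      (Set.right_mem_Icc.2 ht)
  linarith
end

section
/- Let r ≥ 1 and let α₁, …, α_r : ℝ → ℝ be extended class K functions (locally Lipschitz, strictly increasing, vanishing at 0). Let ψ₀, …, ψ_{r-1} : [0,∞) → ℝ be differentiable functions satisfying the recursion ψ_j(t) = ψ'_{j-1}(t) + α_j(ψ_{j-1}(t)) for all 1 ≤ j ≤ r-1 and all t ≥ 0. Suppose ψ_j(0) ≥ 0 for all 0 ≤ j ≤ r-1, and that ψ'_{r-1}(t) + α_r(ψ_{r-1}(t)) ≥ 0 for all t ≥ 0. Then ψ_j(t) ≥ 0 for all 0 ≤ j ≤ r-1 and all t ≥ 0. -/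
/-- If `y 0 ≥ 0` and `y' ≥ -α y` on `[0,∞)`, where `α` is negative on negative numbers, then `y`
stays nonnegative. -/
theorem nonneg_of_deriv_add_comp_nonneg {α y y' : ℝ → ℝ} (hα : ∀ x < 0, α x < 0)
    (hy : ∀ t, 0 ≤ t → HasDerivAt y (y' t) t) (h0 : 0 ≤ y 0)
    (hineq : ∀ t, 0 ≤ t → 0 ≤ y' t + α (y t)) {t : ℝ} (ht : 0 ≤ t) : 0 ≤ y t := by
  refine le_of_forall_pos_le_add fun ε hε => ?_
  have key := image_le_of_deriv_right_lt_deriv_boundary (f := fun s => -y s) (f' := fun s => -y' s)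
    (a := 0) (b := t) (B := fun _ => ε) (B' := fun _ => 0)
    (fun s hs => (hy s hs.1).neg.continuousAt.continuousWithinAt)
    (fun s hs => (hy s hs.1).neg.hasDerivWithinAt) (by linarith)
    (fun s => hasDerivAt_const s ε)
    (fun s hs hsε => by
      have h1 := hα (y s) (by linarith)
      have h2 := hineq s hs.1
      linarith) (Set.right_mem_Icc.2 ht)
  linarith

/-- **HOCBF chain of nonnegativity certificates.** Given extended class K functions
`α₁, …, α_r`, differentiable functions `ψ₀, …, ψ_{r-1}` on `[0,∞)` satisfying the
recursion `ψ_j = ψ'_{j-1} + α_j(ψ_{j-1})` for `1 ≤ j ≤ r-1`, nonnegative initial values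
`ψ_j(0) ≥ 0`, and the final inequality `ψ'_{r-1}(t) + α_r(ψ_{r-1}(t)) ≥ 0` for all `t ≥ 0`,
every `ψ_j` remains nonnegative for all `t ≥ 0`. -/
theorem hocbf_chain (r : ℕ) (hr : 1 ≤ r)
    (α : ℕ → ℝ → ℝ) (hα : ∀ j, 1 ≤ j → j ≤ r → IsExtClassK (α j))
    (ψ ψ' : ℕ → ℝ → ℝ)
    (hderiv : ∀ j, j ≤ r - 1 → ∀ t : ℝ, 0 ≤ t → HasDerivAt (ψ j) (ψ' j t) t)
    (hrec : ∀ j, 1 ≤ j → j ≤ r - 1 → ∀ t : ℝ, 0 ≤ t →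
      ψ j t = ψ' (j - 1) t + α j (ψ (j - 1) t))
    (hinit : ∀ j, j ≤ r - 1 → 0 ≤ ψ j 0)
    (hfinal : ∀ t : ℝ, 0 ≤ t → ψ' (r - 1) t + α r (ψ (r - 1) t) ≥ 0) :
    ∀ j, j ≤ r - 1 → ∀ t : ℝ, 0 ≤ t → 0 ≤ ψ j t := by
  have hneg : ∀ j, 1 ≤ j → j ≤ r → ∀ x < 0, α j x < 0 := fun j h1 hj x hx => by
    obtain ⟨-, hmono, hzero⟩ := hα j h1 hj
    simpa [hzero] using hmono hx
  intro j hj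
  induction hj using Nat.decreasingInduction with
  | self =>
    exact fun t => nonneg_of_deriv_add_comp_nonneg (hneg r hr le_rfl) (hderiv _ le_rfl)
      (hinit _ le_rfl) hfinal
  | of_succ k hk ih =>
    refine fun t => nonneg_of_deriv_add_comp_nonneg (hneg (k + 1) (by omega) (by omega))
      (hderiv k hk.le) (hinit k hk.le) fun s hs => ?_
    have h := hrec (k + 1) (by omega) hk s hs
    rw [Nat.add_sub_cancel] at h
    exact h ▸ ih s hs
end

section
/- Consider the control-affine system ẋ = f(x) + g(x)u with locally Lipschitz f : ℝⁿ → ℝⁿ and g : ℝⁿ → ℝ^{n×m}, and admissible input set U ⊆ ℝ^m. Let q : ℝⁿ → ℝⁿ be a C¹ diffeomorphism that is an infinitesimal symmetry of the dynamics: Dq(x) f(x) = f(q(x)) and Dq(x) g(x) = g(q(x)) for all x ∈ ℝⁿ, where Dq(x) denotes the Jacobian of q at x. Let h : ℝⁿ → ℝ be continuously differentiable and α a class K function such that for every x with h(x) ≥ 0 there exists u ∈ U with ∇h(x)·(f(x) + g(x)u) + α(h(x)) ≥ 0. Then h ∘ q⁻¹ satisfies the same property with the same α: for every y with h(q⁻¹(y))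 ≥ 0 there exists u ∈ U with ∇(h∘q⁻¹)(y)·(f(y) + g(y)u) + α(h(q⁻¹(y))) ≥ 0. In particular, ∇(h∘q⁻¹)(q(x))·f(q(x)) = ∇h(x)·f(x) and ∇(h∘q⁻¹)(q(x))·g(q(x)) = ∇h(x)·g(x) for all x. -/
/-- A class K function: continuous and strictly increasing on `[0,∞)`, vanishing at `0`. -/
def IsClassK (α : ℝ → ℝ) : Prop :=
  ContinuousOn α (Set.Ici 0) ∧ StrictMonoOn α (Set.Ici 0) ∧ α 0 = 0

/-- If `qinv` is a left inverse of `q`, the derivative of `h ∘ qinv` at `q x` takes the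
pushforward of `v` along `q` to the derivative of `h` at `x` in the direction `v`. -/
theorem fderiv_comp_leftInverse_apply {E F G : Type*}
    [NormedAddCommGroup E] [NormedSpace ℝ E] [NormedAddCommGroup F] [NormedSpace ℝ F]
    [NormedAddCommGroup G] [NormedSpace ℝ G] {q : E → F} {qinv : F → E} {h : E → G}
    (hq : Differentiable ℝ q) (hqinv : Differentiable ℝ qinv) (hh : Differentiable ℝ h)
    (hleft : Function.LeftInverse qinv q) (x v : E) :
    fderiv ℝ (h ∘ qinv) (q x) (fderiv ℝ q x v) = fderiv ℝ h x v := by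
  have hcomp : (h ∘ qinv) ∘ q = h := by
    rw [Function.comp_assoc, hleft.comp_eq_id, Function.comp_id]
  rw [← ContinuousLinearMap.comp_apply,
    ← fderiv_comp x ((hh.comp hqinv) (q x)) (hq x), hcomp]

/-- **Symmetry-induced CBF (relative degree one case of Theorem 2).** If `q` is a `C¹`
diffeomorphism that is an infinitesimal symmetry of `ẋ = f(x) + g(x)u`
(`Dq(x) f(x) = f(q(x))` and `Dq(x) g(x) = g(q(x))`), and `h` is a CBF with class K
function `α`, then `h ∘ q⁻¹` satisfies the same CBF property with the same `α`;
moreover `∇(h∘q⁻¹)(q(x))·f(q(x)) = ∇h(x)·f(x)` and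
`∇(h∘q⁻¹)(q(x))·g(q(x)) = ∇h(x)·g(x)` for all `x`. -/
theorem symmetry_induced_cbf {n m : ℕ}
    (f : (Fin n → ℝ) → (Fin n → ℝ))
    (g : (Fin n → ℝ) → ((Fin m → ℝ) →L[ℝ] (Fin n → ℝ)))
    (hf : LocallyLipschitz f) (hg : LocallyLipschitz g)
    (U : Set (Fin m → ℝ))
    (q qinv : (Fin n → ℝ) → (Fin n → ℝ))
    (hq : ContDiff ℝ 1 q) (hqinv : ContDiff ℝ 1 qinv)
    (hleft : Function.LeftInverse qinv q) (hright : Function.RightInverse qinv q)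
    (hsymf : ∀ x : Fin n → ℝ, fderiv ℝ q x (f x) = f (q x))
    (hsymg : ∀ (x : Fin n → ℝ) (u : Fin m → ℝ), fderiv ℝ q x (g x u) = g (q x) u)
    (h : (Fin n → ℝ) → ℝ) (hh : ContDiff ℝ 1 h)
    (α : ℝ → ℝ) (hα : IsClassK α)
    (hcbf : ∀ x : Fin n → ℝ, 0 ≤ h x →
      ∃ u ∈ U, fderiv ℝ h x (f x + g x u) + α (h x) ≥ 0) :
    (∀ y : Fin n → ℝ, 0 ≤ h (qinv y) →
      ∃ u ∈ U, fderiv ℝ (h ∘ qinv) y (f y + g y u) + α (h (qinv y)) ≥ 0) ∧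
    (∀ x : Fin n → ℝ,
      fderiv ℝ (h ∘ qinv) (q x) (f (q x)) = fderiv ℝ h x (f x) ∧
      ∀ u : Fin m → ℝ,
        fderiv ℝ (h ∘ qinv) (q x) (g (q x) u) = fderiv ℝ h x (g x u)) := by
  have key : ∀ x v, fderiv ℝ (h ∘ qinv) (q x) (fderiv ℝ q x v) = fderiv ℝ h x v :=
    fderiv_comp_leftInverse_apply (hq.differentiable one_ne_zero)
      (hqinv.differentiable one_ne_zero) (hh.differentiable one_ne_zero) hleft
  refine ⟨fun y hy => ?_, fun x => ⟨by rw [← hsymf, key], fun u => by rw [← hsymg, key]⟩⟩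
  obtain ⟨u, hu, hle⟩ := hcbf (qinv y) hy
  refine ⟨u, hu, ?_⟩
  rwa [← key, map_add, hsymf, hsymg, hright y] at hle
end

section
/- Let f : ℝⁿ → ℝⁿ be smooth, g : ℝⁿ → ℝ^{n×m} smooth, h : ℝⁿ → ℝ smooth, and r ≥ 2. Define the Lie derivatives L_f φ(x) = ∇φ(x)·f(x) and L_g φ(x) = ∇φ(x)·g(x) (a row vector in ℝ^{1×m}). Suppose h has relative degree r in the sense that L_g L_f^i h(x) = 0 for all x ∈ ℝⁿ and all 0 ≤ i ≤ r−2. Let α_j : ℝ → ℝ be C^{r−j} functions and define recursively ψ₀ = h and ψ_j(x) = L_f ψ_{j−1}(x) + α_j(ψ_{j−1}(x)) for 1 ≤ j ≤ r−1. Then L_g L_f^i ψ_j(x) = 0 for all x ∈ ℝⁿ and all i, j ≥ 0 with i + j ≤ r − 2; in particular each ψ_j has relative degree at least r − j. -/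
/-- Lie derivative of a scalar function `φ` along the vector field `f`:
`L_f φ (x) = ∇φ(x) · f(x)`. -/
noncomputable def LieD {n : ℕ} (f : (Fin n → ℝ) → (Fin n → ℝ))
    (φ : (Fin n → ℝ) → ℝ) : (Fin n → ℝ) → ℝ :=
  fun x => fderiv ℝ φ x (f x)

/-- `φ` is `C^{k+1}` and its first `k` iterated Lie derivatives along `f`
(starting with `φ` itself) are annihilated by the input directions `g`. -/
def RelDegreeGT {n m : ℕ} (f : (Fin n → ℝ) → (Fin n → ℝ))
    (g : (Fin n → ℝ) → ((Fin m → ℝ) →L[ℝ] (Fin n → ℝ))) :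
    ℕ → ((Fin n → ℝ) → ℝ) → Prop
  | 0, φ => ContDiff ℝ 1 φ
  | k + 1, φ => ContDiff ℝ (k + 2 : ℕ) φ ∧ (∀ x u, fderiv ℝ φ x (g x u) = 0) ∧
      RelDegreeGT f g k (LieD f φ)

theorem ContDiff.lieD {n : ℕ} {f : (Fin n → ℝ) → (Fin n → ℝ)} {φ : (Fin n → ℝ) → ℝ}
    (hf : ContDiff ℝ (⊤ : ℕ∞) f) (hφ : ContDiff ℝ (⊤ : ℕ∞) φ) :
    ContDiff ℝ (⊤ : ℕ∞) (LieD f φ) :=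
  (hφ.fderiv_right (m := (⊤ : ℕ∞)) (by simp)).clm_apply hf

namespace RelDegreeGT

variable {n m : ℕ} {f : (Fin n → ℝ) → (Fin n → ℝ)}
  {g : (Fin n → ℝ) → ((Fin m → ℝ) →L[ℝ] (Fin n → ℝ))} {k : ℕ} {φ χ : (Fin n → ℝ) → ℝ}

theorem contDiff (hφ : RelDegreeGT f g k φ) : ContDiff ℝ (k + 1 : ℕ) φ := by
  cases k with
  | zero => simpa [RelDegreeGT] using hφ
  | succ k => exact hφ.1

theorem differentiable (hφ : RelDegreeGT f g k φ) : Differentiable ℝ φ :=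
  hφ.contDiff.differentiable (by simp)

theorem of_succ (hφ : RelDegreeGT f g (k + 1) φ) : RelDegreeGT f g k φ := by
  induction k generalizing φ with
  | zero => exact hφ.1.of_le (by norm_num)
  | succ k ih => exact ⟨hφ.1.of_le (by exact_mod_cast Nat.le_succ _), hφ.2.1, ih hφ.2.2⟩

theorem add (hφ : RelDegreeGT f g k φ) (hχ : RelDegreeGT f g k χ) :
    RelDegreeGT f g k (fun x => φ x + χ x) := by
  induction k generalizing φ χ with
  | zero => exact ContDiff.add hφ hχ
  | succ k ih =>
    have hd : ∀ x, fderiv ℝ (fun x => φ x + χ x) x = fderiv ℝ φ x + fderiv ℝ χ x :=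
      fun x => fderiv_fun_add (hφ.differentiable x) (hχ.differentiable x)
    refine ⟨hφ.1.add hχ.1, fun x u => by simp [hd, hφ.2.1, hχ.2.1], ?_⟩
    have hL : LieD f (fun x => φ x + χ x) = fun x => LieD f φ x + LieD f χ x := by
      funext x
      simp [LieD, hd]
    rw [hL]
    exact ih hφ.2.2 hχ.2.2

theorem mul (hφ : RelDegreeGT f g k φ) (hχ : RelDegreeGT f g k χ) :
    RelDegreeGT f g k (fun x => φ x * χ x) := by
  induction k generalizing φ χ with
  | zero => exact ContDiff.mul hφ hχ
  | succ k ih =>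
    have hd : ∀ x, fderiv ℝ (fun x => φ x * χ x) x = φ x • fderiv ℝ χ x + χ x • fderiv ℝ φ x :=
      fun x => fderiv_fun_mul (hφ.differentiable x) (hχ.differentiable x)
    refine ⟨hφ.1.mul hχ.1, fun x u => by simp [hd, hφ.2.1, hχ.2.1], ?_⟩
    have hL : LieD f (fun x => φ x * χ x) =
        fun x => φ x * LieD f χ x + χ x * LieD f φ x := by
      funext x
      simp [LieD, hd]
    rw [hL]
    exact (ih hφ.of_succ hχ.2.2).add (ih hχ.of_succ hφ.2.2)

theorem comp {a : ℝ → ℝ} (ha : ContDiff ℝ (k + 1 : ℕ) a) (hφ : RelDegreeGT f g k φ) :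
    RelDegreeGT f g k (fun x => a (φ x)) := by
  induction k generalizing a φ with
  | zero => exact ContDiff.comp (by simpa using ha) hφ
  | succ k ih =>
    have hd : ∀ x, fderiv ℝ (fun x => a (φ x)) x = deriv a (φ x) • fderiv ℝ φ x := fun x =>
      ((ha.differentiable (by simp) (φ x)).hasDerivAt.comp_hasFDerivAt x
        (hφ.differentiable x).hasFDerivAt).fderiv
    refine ⟨ha.comp hφ.1, fun x u => by simp [hd, hφ.2.1], ?_⟩
    have hL : LieD f (fun x => a (φ x)) = fun x => deriv a (φ x) * LieD f φ x := by
      funext x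
      simp [LieD, hd]
    rw [hL]
    have ha' : ContDiff ℝ (k + 1 : ℕ) (deriv a) :=
      (contDiff_succ_iff_deriv.1 (by exact_mod_cast ha)).2.2
    exact (ih ha' hφ.of_succ).mul hφ.2.2

theorem of_smooth (hf : ContDiff ℝ (⊤ : ℕ∞) f) (hφ : ContDiff ℝ (⊤ : ℕ∞) φ)
    (hg : ∀ i < k, ∀ x u, fderiv ℝ ((LieD f)^[i] φ) x (g x u) = 0) :
    RelDegreeGT f g k φ := by
  induction k generalizing φ with
  | zero => exact hφ.of_le (by exact_mod_cast le_top)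
  | succ k ih =>
    exact ⟨contDiff_infty.1 hφ _, hg 0 k.succ_pos,
      ih (hf.lieD hφ) fun i hi => hg (i + 1) (by omega)⟩

theorem fderiv_iterate_lieD (hφ : RelDegreeGT f g k φ) {i : ℕ} (hi : i < k)
    (x : Fin n → ℝ) (u : Fin m → ℝ) : fderiv ℝ ((LieD f)^[i] φ) x (g x u) = 0 := by
  induction i generalizing k φ with
  | zero =>
    cases k with
    | zero => omega
    | succ k => exact hφ.2.1 x u
  | succ i ih =>
    cases k with
    | zero => omega
    | succ k => exact ih hφ.2.2 (by omega)

end RelDegreeGT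

/-- **The HOCBF functions `ψⱼ` inherit high relative degree.** If `h` has relative
degree `r` (`L_g L_f^i h = 0` for `0 ≤ i ≤ r−2`) and
`ψ₀ = h`, `ψⱼ = L_f ψ_{j−1} + αⱼ(ψ_{j−1})` for `1 ≤ j ≤ r−1` with `αⱼ ∈ C^{r−j}`,
then `L_g L_f^i ψⱼ = 0` whenever `i + j ≤ r − 2`; in particular each `ψⱼ` has
relative degree at least `r − j`. -/
theorem hocbf_relative_degree {n m : ℕ}
    (f : (Fin n → ℝ) → (Fin n → ℝ)) (hf : ContDiff ℝ (⊤ : ℕ∞) f)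
    (g : (Fin n → ℝ) → ((Fin m → ℝ) →L[ℝ] (Fin n → ℝ))) (hg : ContDiff ℝ (⊤ : ℕ∞) g)
    (h : (Fin n → ℝ) → ℝ) (hh : ContDiff ℝ (⊤ : ℕ∞) h)
    (r : ℕ) (hr : 2 ≤ r)
    (hreldeg : ∀ i : ℕ, i ≤ r - 2 → ∀ (x : Fin n → ℝ) (u : Fin m → ℝ),
      fderiv ℝ ((LieD f)^[i] h) x (g x u) = 0)
    (α : ℕ → ℝ → ℝ)
    (hα : ∀ j : ℕ, 1 ≤ j → j ≤ r - 1 → ContDiff ℝ (r - j : ℕ) (α j))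
    (ψ : ℕ → (Fin n → ℝ) → ℝ)
    (hψ0 : ψ 0 = h)
    (hψrec : ∀ j : ℕ, 1 ≤ j → j ≤ r - 1 →
      ψ j = fun x => LieD f (ψ (j - 1)) x + α j (ψ (j - 1) x)) :
    ∀ i j : ℕ, i + j ≤ r - 2 → ∀ (x : Fin n → ℝ) (u : Fin m → ℝ),
      fderiv ℝ ((LieD f)^[i] (ψ j)) x (g x u) = 0 := by
  have key : ∀ j ≤ r - 1, RelDegreeGT f g (r - 1 - j) (ψ j) := by
    intro j
    induction j with
    | zero =>
      intro _
      rw [hψ0]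
      exact .of_smooth hf hh fun i hi => hreldeg i (by omega)
    | succ j ih =>
      intro hj
      have hprev : RelDegreeGT f g (r - 1 - (j + 1) + 1) (ψ j) := by
        convert ih (by omega) using 1
        omega
      have hα' : ContDiff ℝ (r - 1 - (j + 1) + 1 : ℕ) (α (j + 1)) := by
        convert hα (j + 1) (by omega) hj using 2
        omega
      rw [hψrec (j + 1) (by omega) hj]
      exact hprev.2.2.add (.comp hα' hprev.of_succ)
  intro i j hij
  exact (key j (by omega)).fderiv_iterate_lieD (by omega)
end

section
/- Consider the planar bicycle-like dynamics on ℝ⁴: ẋ₁ = x₃ cos x₄, ẋ₂ = x₃ sin x₄, ẋ₃ = u₁, ẋ₄ = x₃ u₂, with input constraint (u₁,u₂) ∈ [−1,1] × [−1,1]. For ε > 0 define V(x) = √(x₁² + 4x₂² + ε²) − ε + x₃²/2 + 1 − cos x₄, and define the feedback u(x) = (1/√(x₁² + 4x₂² + ε²)) · (−x₁ cos x₄ − 2x₂ sin x₄, −2x₂). Then for every x ∈ ℝ⁴: (i) |u₁(x)| ≤ 1 and |u₂(x)| ≤ 1, and (ii) the derivative of V along the closed-loop vector field is nonpositive, i.e.,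 ∇V(x) · (x₃ cos x₄, x₃ sin x₄, u₁(x), x₃ u₂(x)) ≤ 0. -/
open Real

/-- The handcrafted control Lyapunov function for the bicycle dynamics:
`V(x) = √(x₁² + 4x₂² + ε²) − ε + x₃²/2 + 1 − cos x₄`. -/
noncomputable def bicycleV (ε : ℝ) (x : Fin 4 → ℝ) : ℝ :=
  Real.sqrt ((x 0) ^ 2 + 4 * (x 1) ^ 2 + ε ^ 2) - ε + (x 2) ^ 2 / 2 + 1 - Real.cos (x 3)

/-- The stabilizing feedback
`u(x) = (1/√(x₁² + 4x₂² + ε²)) · (−x₁ cos x₄ − 2x₂ sin x₄, −2x₂)`. -/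
noncomputable def bicycleU (ε : ℝ) (x : Fin 4 → ℝ) : Fin 2 → ℝ :=
  ![(-(x 0) * Real.cos (x 3) - 2 * x 1 * Real.sin (x 3)) /
      Real.sqrt ((x 0) ^ 2 + 4 * (x 1) ^ 2 + ε ^ 2),
    (-2 * x 1) / Real.sqrt ((x 0) ^ 2 + 4 * (x 1) ^ 2 + ε ^ 2)]

/-- The derivative of `bicycleV` at a state `x`. -/
theorem hasFDerivAt_bicycleV {ε : ℝ} (hε : 0 < ε) (x : Fin 4 → ℝ) :
    HasFDerivAt (bicycleV ε)
      ((x 0 / √((x 0) ^ 2 + 4 * (x 1) ^ 2 + ε ^ 2)) •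
          ContinuousLinearMap.proj (R := ℝ) (φ := fun _ : Fin 4 => ℝ) 0 +
        (4 * x 1 / √((x 0) ^ 2 + 4 * (x 1) ^ 2 + ε ^ 2)) • ContinuousLinearMap.proj 1 +
        x 2 • ContinuousLinearMap.proj 2 + sin (x 3) • ContinuousLinearMap.proj 3) x := by
  have hpos : 0 < (x 0) ^ 2 + 4 * (x 1) ^ 2 + ε ^ 2 := by positivity
  have hproj (i : Fin 4) := hasFDerivAt_apply (𝕜 := ℝ) (F' := fun _ : Fin 4 => ℝ) i x
  have hV := (((((((hproj 0).pow 2).add (((hproj 1).pow 2).const_mul 4)).add_const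
    (ε ^ 2)).sqrt hpos.ne').sub_const ε).add (((hproj 2).pow 2).mul_const (2⁻¹))).add_const 1
    |>.sub (hproj 3).cos
  refine (hV.congr_fderiv ?_).congr_of_eventuallyEq (.of_forall fun y => ?_)
  · ext v
    have := (sqrt_pos.mpr hpos).ne'
    simp
    field_simp
  · simp [bicycleV, div_eq_mul_inv]

/-- **The handcrafted `V` is a control Lyapunov function for the bicycle dynamics
with admissible feedback.** For every state: (i) both feedback components lie in
`[−1,1]`, and (ii) the derivative of `V` along the closed-loop vector field
`(x₃ cos x₄, x₃ sin x₄, u₁(x), x₃ u₂(x))` is nonpositive. -/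
theorem bicycle_clf (ε : ℝ) (hε : 0 < ε) :
    ∀ x : Fin 4 → ℝ,
      |bicycleU ε x 0| ≤ 1 ∧ |bicycleU ε x 1| ≤ 1 ∧
      fderiv ℝ (bicycleV ε) x
        ![x 2 * Real.cos (x 3), x 2 * Real.sin (x 3),
          bicycleU ε x 0, x 2 * bicycleU ε x 1] ≤ 0 := by
  intro x
  have hpos : 0 < (x 0) ^ 2 + 4 * (x 1) ^ 2 + ε ^ 2 := by positivity
  have hr := sqrt_pos.mpr hpos
  refine ⟨?_, ?_, ?_⟩
  · simp only [bicycleU, Matrix.cons_val_zero]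
    rw [abs_div, abs_of_pos hr, div_le_one hr]
    refine abs_le_sqrt ?_
    have hsplit : (-(x 0) * cos (x 3) - 2 * x 1 * sin (x 3)) ^ 2 +
        (x 0 * sin (x 3) - 2 * x 1 * cos (x 3)) ^ 2 = (x 0) ^ 2 + 4 * (x 1) ^ 2 := by
      linear_combination ((x 0) ^ 2 + 4 * (x 1) ^ 2) * sin_sq_add_cos_sq (x 3)
    nlinarith [sq_nonneg (x 0 * sin (x 3) - 2 * x 1 * cos (x 3)), sq_nonneg ε]
  · simp only [bicycleU, Matrix.cons_val_one, Matrix.cons_val_zero]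
    rw [abs_div, abs_of_pos hr, div_le_one hr]
    refine abs_le_sqrt ?_
    nlinarith [sq_nonneg (x 0), sq_nonneg ε]
  · rw [(hasFDerivAt_bicycleV hε x).fderiv]
    refine le_of_eq ?_
    simp [bicycleU]
    field_simp
    ring
end

section
/- Consider the augmented system ẋ = f(x) + g(x)u, k̇ = v on ℝⁿ × ℝ^{n_k} with smooth f, g. Let φ₀, …, φ_{r−1} : ℝⁿ × ℝ^{n_k} → ℝ be continuously differentiable, let ρ_i : ℝ^{n_k} → ℝ (i ∈ I) be continuously differentiable, and let α_j(·,k) (1 ≤ j ≤ r) and β_i be extended class K functions, continuous in all arguments and locally Lipschitz in their scalar argument locally uniformly in k. Suppose (x,k) : [0,∞) → ℝⁿ × ℝ^{n_k} is a differentiable trajectory of the augmented system such that for all t ≥ 0: (d/dt) φ_{j−1}(x(t),k(t)) + α_j(φ_{j−1}(x(t),k(t)), k(t)) ≥ 0 for every 1 ≤ j ≤ r, and (d/dt) ρ_i(k(t)) + β_i(ρ_i(k(t))) ≥ 0 for every i ∈ I. If φ_{j−1}(x(0),k(0)) ≥ 0 for all 1 ≤ j ≤ r and ρ_i(k(0))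 ≥ 0 for all i ∈ I, then φ_{j−1}(x(t),k(t)) ≥ 0 and ρ_i(k(t)) ≥ 0 for all t ≥ 0, all 1 ≤ j ≤ r, and all i ∈ I; that is, the trajectory remains in C̄ = {(x,k) : φ_{j−1}(x,k) ≥ 0 ∀j, ρ_i(k) ≥ 0 ∀i}. -/
/-- A function on `[0, ∞)` that starts nonnegative and has positive derivative wherever it is
negative stays nonnegative. -/
theorem nonneg_of_hasDerivAt_pos_of_neg {y y' : ℝ → ℝ}
    (hy : ∀ t : ℝ, 0 ≤ t → HasDerivAt y (y' t) t)
    (hpos : ∀ t : ℝ, 0 ≤ t → y t < 0 → 0 < y' t) (h0 : 0 ≤ y 0) :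
    ∀ t : ℝ, 0 ≤ t → 0 ≤ y t := by
  intro T hT
  by_contra! hneg
  obtain ⟨c, hc, hmin⟩ := isCompact_Icc.exists_isMinOn (Set.nonempty_Icc.2 hT)
    (fun t ht => (hy t ht.1).continuousAt.continuousWithinAt)
  have hyc : y c < 0 := (hmin (Set.right_mem_Icc.2 hT)).trans_lt hneg
  have hc0 : 0 < c := hc.1.lt_of_ne (by rintro rfl; exact absurd h0 hyc.not_ge)
  have hseg : segment ℝ c 0 ⊆ Set.Icc 0 T :=
    (convex_Icc 0 T).segment_subset hc (Set.left_mem_Icc.2 hT)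
  have key := hmin.localize.hasFDerivWithinAt_nonneg
    (hy c hc.1).hasFDerivAt.hasFDerivWithinAt (sub_mem_posTangentConeAt_of_segment_subset hseg)
  simp at key
  nlinarith [mul_pos hc0 (hpos c hc.1 hyc)]

/-- Comparison principle: if `y' + a t (y t) ≥ 0` with each `a t` strictly increasing and
vanishing at `0`, then nonnegativity of `y` at time `0` persists. -/
theorem nonneg_of_hasDerivAt_add_strictMono_nonneg {y y' : ℝ → ℝ} {a : ℝ → ℝ → ℝ}
    (hy : ∀ t : ℝ, 0 ≤ t → HasDerivAt y (y' t) t)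
    (ha : ∀ t, StrictMono (a t)) (ha0 : ∀ t, a t 0 = 0)
    (hineq : ∀ t : ℝ, 0 ≤ t → y' t + a t (y t) ≥ 0) (h0 : 0 ≤ y 0) :
    ∀ t : ℝ, 0 ≤ t → 0 ≤ y t := by
  refine nonneg_of_hasDerivAt_pos_of_neg hy (fun t ht hneg => ?_) h0
  have hat := ha t hneg
  rw [ha0] at hat
  linarith [hineq t ht]

/-- **Invariance guarantee of the HOPCBF-QP controller.** Along any differentiable
trajectory `(x(t), k(t))` of the augmented system `ẋ = f(x) + g(x)u, k̇ = v`
whose inputs satisfy the smoothened Nagumo-type constraints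
`(d/dt) φ_{j−1}(x,k) + αⱼ(φ_{j−1}(x,k), k) ≥ 0` for `1 ≤ j ≤ r` and
`(d/dt) ρᵢ(k) + βᵢ(ρᵢ(k)) ≥ 0` for all `i`, nonnegativity of all `φ_{j−1}` and all
`ρᵢ` at `t = 0` is preserved for all `t ≥ 0`, i.e. the trajectory stays in `C̄`. -/
theorem hopcbf_qp_invariance {n m nk : ℕ} {I : Type*}
    (f : (Fin n → ℝ) → (Fin n → ℝ)) (hf : ContDiff ℝ (⊤ : ℕ∞) f)
    (g : (Fin n → ℝ) → ((Fin m → ℝ) →L[ℝ] (Fin n → ℝ))) (hg : ContDiff ℝ (⊤ : ℕ∞) g)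
    (r : ℕ) (hr : 1 ≤ r)
    (φ : ℕ → (Fin n → ℝ) → (Fin nk → ℝ) → ℝ)
    (hφ : ∀ j, 1 ≤ j → j ≤ r →
      ContDiff ℝ 1 (fun p : (Fin n → ℝ) × (Fin nk → ℝ) => φ (j - 1) p.1 p.2))
    (ρ : I → (Fin nk → ℝ) → ℝ) (hρ : ∀ i, ContDiff ℝ 1 (ρ i))
    -- each `αⱼ(·,k)` is an extended class K function:
    (α : ℕ → ℝ → (Fin nk → ℝ) → ℝ)
    (hαK : ∀ j, 1 ≤ j → j ≤ r → ∀ k : Fin nk → ℝ,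
      StrictMono (fun y => α j y k) ∧ α j 0 k = 0)
    -- each `αⱼ` is continuous and locally Lipschitz in its scalar argument
    -- locally uniformly in `k`:
    (hαcont : ∀ j, 1 ≤ j → j ≤ r →
      Continuous (fun p : ℝ × (Fin nk → ℝ) => α j p.1 p.2))
    (hαlip : ∀ j, 1 ≤ j → j ≤ r → ∀ (y₀ : ℝ) (k₀ : Fin nk → ℝ),
      ∃ (L : NNReal) (s : Set ℝ) (sk : Set (Fin nk → ℝ)),
        s ∈ nhds y₀ ∧ sk ∈ nhds k₀ ∧ ∀ k ∈ sk, LipschitzOnWith L (fun y => α j y k) s)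
    -- each `βᵢ` is an extended class K function:
    (β : I → ℝ → ℝ)
    (hβ : ∀ i, LocallyLipschitz (β i) ∧ StrictMono (β i) ∧ β i 0 = 0)
    -- the trajectory of the augmented system with inputs `u`, `v`:
    (x : ℝ → (Fin n → ℝ)) (k : ℝ → (Fin nk → ℝ))
    (u : ℝ → (Fin m → ℝ)) (v : ℝ → (Fin nk → ℝ))
    (hx : ∀ t : ℝ, 0 ≤ t → HasDerivAt x (f (x t) + g (x t) (u t)) t)
    (hk : ∀ t : ℝ, 0 ≤ t → HasDerivAt k (v t) t)
    -- the inputs satisfy the smoothened Nagumo-type constraints: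
    (φd : ℕ → ℝ → ℝ) (ρd : I → ℝ → ℝ)
    (hφd : ∀ j, 1 ≤ j → j ≤ r → ∀ t : ℝ, 0 ≤ t →
      HasDerivAt (fun s => φ (j - 1) (x s) (k s)) (φd j t) t)
    (hρd : ∀ i, ∀ t : ℝ, 0 ≤ t → HasDerivAt (fun s => ρ i (k s)) (ρd i t) t)
    (hφineq : ∀ j, 1 ≤ j → j ≤ r → ∀ t : ℝ, 0 ≤ t →
      φd j t + α j (φ (j - 1) (x t) (k t)) (k t) ≥ 0)
    (hρineq : ∀ i, ∀ t : ℝ, 0 ≤ t → ρd i t + β i (ρ i (k t)) ≥ 0)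
    -- initial conditions:
    (hφ0 : ∀ j, 1 ≤ j → j ≤ r → 0 ≤ φ (j - 1) (x 0) (k 0))
    (hρ0 : ∀ i, 0 ≤ ρ i (k 0)) :
    ∀ t : ℝ, 0 ≤ t →
      (∀ j, 1 ≤ j → j ≤ r → 0 ≤ φ (j - 1) (x t) (k t)) ∧
      (∀ i, 0 ≤ ρ i (k t)) := by
  exact fun t ht =>
    ⟨fun j hj hjr => nonneg_of_hasDerivAt_add_strictMono_nonneg (a := fun t y => α j y (k t))
        (hφd j hj hjr) (fun t => (hαK j hj hjr (k t)).1) (fun t => (hαK j hj hjr (k t)).2)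
        (hφineq j hj hjr) (hφ0 j hj hjr) t ht,
      fun i => nonneg_of_hasDerivAt_add_strictMono_nonneg (a := fun _ => β i)
        (hρd i) (fun _ => (hβ i).2.1) (fun _ => (hβ i).2.2) (hρineq i) (hρ0 i) t ht⟩
end
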